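/- arXiv:1310.5931 — 2 statements merged into one kernel-verified Lean document; each statement's English description precedes it below -/
import Mathlib

section
/- Let (T(t))_{t≥0} be a uniformly exponentially stable C₀-semigroup on a complex Banach space X with constants K ≥ 1, ω < 0, and let v : [0,∞) → X be Bochner integrable (v ∈ L¹([0,∞), X)). Set f(t) := ∫₀^{t} T(t-r)v(r) dr. Then for every λ ∈ ℂ with Re λ ≥ 0 (in particular for λ = iγ, γ ∈ ℝ), t ↦ e^{-λt} f(t) is Bochner integrable on [0,∞), the integral v̂(λ) := ∫₀^∞ e^{-λr} v(r) dr exists, and ∫₀^∞ e^{-λt} f(t) dt = ∫₀^∞ e^{-λt} T(t)(v̂(λ)) dt. -/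
open MeasureTheory Set

/-- Fubini for the convolution of an operator-valued kernel with a vector-valued function, where the
kernel need not be strongly measurable in operator norm. -/
theorem integrable_and_integral_operator_convolution
    {X : Type*} [NormedAddCommGroup X] [NormedSpace ℂ X] [CompleteSpace X]
    {G : ℝ → X →L[ℂ] X} {g : ℝ → ℝ} {w : ℝ → X}
    (hm : AEStronglyMeasurable (fun p : ℝ × ℝ => G p.1 (w p.2)) (volume.prod volume))
    (hg : Integrable g) (hGg : ∀ s, ‖G s‖ ≤ g s) (hw : Integrable w) :
    Integrable (fun t => ∫ r, G (t - r) (w r)) ∧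
      ∫ t, ∫ r, G (t - r) (w r) = ∫ s, G s (∫ r, w r) := by
  have hH : Integrable (fun p : ℝ × ℝ => G p.1 (w p.2)) (volume.prod volume) := by
    refine (hg.mul_prod hw.norm).mono' hm (Filter.Eventually.of_forall fun p => ?_)
    exact (G p.1).le_of_opNorm_le (hGg p.1) (w p.2)
  have hF : Integrable (fun p : ℝ × ℝ => G (p.1 - p.2) (w p.2)) (volume.prod volume) :=
    (measurePreserving_sub_prod (volume : Measure ℝ)
      (volume : Measure ℝ)).integrable_comp_of_integrable hH
  refine ⟨hF.integral_prod_left, ?_⟩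
  calc ∫ t, ∫ r, G (t - r) (w r) = ∫ r, ∫ t, G (t - r) (w r) :=
        integral_integral_swap hF
    _ = ∫ r, ∫ s, G s (w r) := by
        congr 1 with r
        exact integral_sub_right_eq_self (fun s => G s (w r)) r
    _ = ∫ s, ∫ r, G s (w r) := (integral_integral_swap hH).symm
    _ = ∫ s, G s (∫ r, w r) := by
        congr 1 with s
        exact (G s).integral_comp_comm hw

/-- A strongly continuous, uniformly bounded operator family on the half-line, frozen at its
initial value for negative times, is jointly continuous. -/
theorem continuous_uncurry_max_zero
    {X : Type*} [NormedAddCommGroup X] [NormedSpace ℂ X] {T : ℝ → X →L[ℂ] X} {C : NNReal}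
    (hT : ∀ x : X, ContinuousOn (fun t => T t x) (Ici (0 : ℝ)))
    (hC : ∀ t : ℝ, 0 ≤ t → ‖T t‖ ≤ C) :
    Continuous fun p : ℝ × X => T (max p.1 0) p.2 := by
  refine continuous_prod_of_continuous_lipschitzWith' _ C (fun t => ?_) (fun x => ?_)
  · exact (T (max t 0)).lipschitz.weaken (hC _ (le_max_right t 0))
  · exact (hT x).comp_continuous (by fun_prop) fun t => le_max_right t 0

theorem norm_cexp_neg_mul_ofReal_le_one {lam : ℂ} (hlam : 0 ≤ lam.re) {t : ℝ} (ht : 0 ≤ t) :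
    ‖Complex.exp (-(lam * t))‖ ≤ 1 := by
  rw [Complex.norm_exp, Real.exp_le_one_iff]
  simpa using mul_nonneg hlam ht

/-- Laplace transform of a semigroup convolution on the closed
right half-plane (second part of Lemma 3.25 of the paper): for `v ∈ L¹([0,∞),X)`
and `Re λ ≥ 0`, with `f(t) = ∫₀^t T(t-r) v(r) dr`, one has
`∫₀^∞ e^{-λt} f(t) dt = ∫₀^∞ e^{-λt} T(t) v̂(λ) dt`. -/
theorem stmt_9
    {X : Type*} [NormedAddCommGroup X] [NormedSpace ℂ X] [CompleteSpace X]
    (T : ℝ → X →L[ℂ] X) (K ω : ℝ) (hK : 1 ≤ K) (hω : ω < 0)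
    (hT0 : T 0 = 1)
    (hTmul : ∀ s t : ℝ, 0 ≤ s → 0 ≤ t → T (s + t) = (T s).comp (T t))
    (hTcont : ∀ x : X, ContinuousOn (fun t => T t x) (Ici (0 : ℝ)))
    (hTnorm : ∀ t : ℝ, 0 ≤ t → ‖T t‖ ≤ K * Real.exp (ω * t))
    (v : ℝ → X)
    (hv : IntegrableOn v (Ici (0 : ℝ)))
    (lam : ℂ) (hlam : 0 ≤ lam.re) :
    IntegrableOn (fun r : ℝ => Complex.exp (-(lam * r)) • v r) (Ici (0 : ℝ)) ∧
    IntegrableOn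
      (fun t : ℝ =>
        Complex.exp (-(lam * t)) • ∫ r in Icc (0 : ℝ) t, T (t - r) (v r))
      (Ici (0 : ℝ)) ∧
    ∫ t in Ici (0 : ℝ),
        Complex.exp (-(lam * t)) • ∫ r in Icc (0 : ℝ) t, T (t - r) (v r) =
      ∫ t in Ici (0 : ℝ),
        Complex.exp (-(lam * t)) •
          T t (∫ r in Ici (0 : ℝ), Complex.exp (-(lam * r)) • v r) := by
  set G : ℝ → X →L[ℂ] X :=
    (Ici (0 : ℝ)).indicator fun s => Complex.exp (-(lam * s)) • T s with hG
  set w : ℝ → X := (Ici (0 : ℝ)).indicator fun r => Complex.exp (-(lam * r)) • v r with hw_def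
  set g : ℝ → ℝ := (Ici (0 : ℝ)).indicator fun s => K * Real.exp (ω * s) with hg_def
  have hexp : Continuous fun r : ℝ => Complex.exp (-(lam * r)) := by fun_prop
  have hvexp : IntegrableOn (fun r : ℝ => Complex.exp (-(lam * r)) • v r) (Ici (0 : ℝ)) := by
    refine Integrable.mono hv (hexp.aestronglyMeasurable.smul hv.aestronglyMeasurable) ?_
    filter_upwards [ae_restrict_mem measurableSet_Ici] with r hr
    rw [norm_smul]
    exact mul_le_of_le_one_left (norm_nonneg _) (norm_cexp_neg_mul_ofReal_le_one hlam hr)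
  have hw : Integrable w := hvexp.integrable_indicator measurableSet_Ici
  have hg : Integrable g := by
    refine IntegrableOn.integrable_indicator ?_ measurableSet_Ici
    rw [integrableOn_Ici_iff_integrableOn_Ioi]
    exact (integrableOn_exp_mul_Ioi hω 0).const_mul K
  have hGg : ∀ s, ‖G s‖ ≤ g s := by
    intro s
    by_cases hs : s ∈ Ici (0 : ℝ)
    · simp only [hG, hg_def, indicator_of_mem hs, norm_smul]
      exact (mul_le_of_le_one_left (norm_nonneg _)
        (norm_cexp_neg_mul_ofReal_le_one hlam hs)).trans (hTnorm s hs)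
    · simp [hG, hg_def, indicator_of_notMem hs]
  have hm : AEStronglyMeasurable (fun p : ℝ × ℝ => G p.1 (w p.2)) (volume.prod volume) := by
    have hcont : Continuous fun p : ℝ × X => T (max p.1 0) p.2 := by
      refine continuous_uncurry_max_zero (C := ⟨K, by linarith⟩) hTcont fun t ht => ?_
      refine (hTnorm t ht).trans (mul_le_of_le_one_right (by linarith) ?_)
      exact Real.exp_le_one_iff.2 (mul_nonpos_of_nonpos_of_nonneg hω.le ht)
    have hS : AEStronglyMeasurable (fun p : ℝ × ℝ =>
        Complex.exp (-(lam * p.1)) • T (max p.1 0) (w p.2)) (volume.prod volume) :=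
      (hexp.comp continuous_fst).aestronglyMeasurable.smul
        (hcont.comp_aestronglyMeasurable
          (continuous_fst.aestronglyMeasurable.prodMk hw.aestronglyMeasurable.comp_snd))
    refine (hS.indicator (measurable_fst measurableSet_Ici :
      MeasurableSet (Prod.fst ⁻¹' Ici (0 : ℝ)))).congr (Filter.Eventually.of_forall fun p => ?_)
    by_cases hp : 0 ≤ p.1 <;> simp [hG, indicator, hp]
  have hconv : ∀ t, ∫ r, G (t - r) (w r) = (Ici (0 : ℝ)).indicator (fun t : ℝ =>
      Complex.exp (-(lam * t)) • ∫ r in Icc (0 : ℝ) t, T (t - r) (v r)) t := by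
    intro t
    have hpoint : ∀ r, G (t - r) (w r) = (Icc (0 : ℝ) t).indicator
        (fun r => Complex.exp (-(lam * t)) • T (t - r) (v r)) r := by
      intro r
      by_cases hr : 0 ≤ r
      · by_cases hrt : r ≤ t
        · simp only [hG, hw_def, indicator, mem_Ici, mem_Icc, sub_nonneg, hr, hrt, and_self,
            if_true, smul_apply, map_smul, smul_smul, ← Complex.exp_add]
          congr 2
          push_cast
          ring
        · simp [hG, indicator, hrt]
      · simp [hw_def, indicator, hr]
    simp_rw [hpoint]
    rw [integral_indicator measurableSet_Icc, integral_smul]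
    by_cases ht : 0 ≤ t
    · simp [indicator, ht]
    · simp [indicator, ht]
  obtain ⟨hint, heq⟩ := integrable_and_integral_operator_convolution hm hg hGg hw
  simp_rw [hconv] at hint heq
  refine ⟨hvexp, (integrable_indicator_iff measurableSet_Ici).1 hint, ?_⟩
  rw [integral_indicator measurableSet_Ici] at heq
  rw [heq, ← integral_indicator measurableSet_Ici, ← integral_indicator measurableSet_Ici]
  congr 1 with s
  by_cases hs : 0 ≤ s <;> simp [hG, hw_def, indicator, hs]
end

section
/- For n ∈ ℕ let δ_n := 1 if n = 0 and δ_n := 2 if n ≥ 1, and c_n := √(δ_n/π)·cos(nπ/2). Then for every t₀ > 0 and every z = (z_n)_{n∈ℕ} ∈ ℓ²(ℕ,ℂ): for each s > 0 the series ∑_{n=0}^∞ c_n·e^{-(1+n²)s}·z_n converges absolutely, and ∫₀^{t₀} | ∑_{n=0}^∞ c_n·e^{-(1+n²)s}·z_n |² ds ≤ (1/π)·(∑_{n=0}^∞ 1/(1+n²))·‖z‖²_{ℓ²}. -/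
open MeasureTheory Set
open scoped Real

/-- `δ_n = 1` if `n = 0` and `δ_n = 2` if `n ≥ 1`. -/
noncomputable def heatDelta (n : ℕ) : ℝ := if n = 0 then 1 else 2

/-- `c_n = √(δ_n/π)·cos(nπ/2)`, the value `e_n(π/2)` of the `n`-th basis
function at the observation point. -/
noncomputable def heatC (n : ℕ) : ℝ :=
  Real.sqrt (heatDelta n / π) * Real.cos (n * π / 2)

/-- Cauchy–Schwarz for series of nonnegative reals. -/
theorem summable_and_sq_tsum_mul_le {ι : Type*} {f g : ι → ℝ} (hf : ∀ i, 0 ≤ f i)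
    (hg : ∀ i, 0 ≤ g i) (hf_sum : Summable fun i => f i ^ 2) (hg_sum : Summable fun i => g i ^ 2) :
    (Summable fun i => f i * g i) ∧
      (∑' i, f i * g i) ^ 2 ≤ (∑' i, f i ^ 2) * ∑' i, g i ^ 2 := by
  obtain ⟨h₁, h₂⟩ := Real.summable_and_inner_le_Lp_mul_Lq_tsum_of_nonneg
    Real.HolderConjugate.two_two hf hg (by simpa using hf_sum) (by simpa using hg_sum)
  refine ⟨h₁, ?_⟩
  simp only [Real.rpow_two, ← Real.sqrt_eq_rpow] at h₂
  have h := pow_le_pow_left₀ (tsum_nonneg fun i => mul_nonneg (hf i) (hg i)) h₂ 2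
  rwa [mul_pow, Real.sq_sqrt (tsum_nonneg fun i => sq_nonneg _),
    Real.sq_sqrt (tsum_nonneg fun i => sq_nonneg _)] at h

theorem heatC_sq_le (n : ℕ) : heatC n ^ 2 ≤ 2 / π := by
  have hδ : 0 ≤ heatDelta n ∧ heatDelta n ≤ 2 := by
    unfold heatDelta; split_ifs <;> norm_num
  have hπ := Real.pi_pos
  rw [heatC, mul_pow, Real.sq_sqrt (div_nonneg hδ.1 hπ.le)]
  calc heatDelta n / π * Real.cos (n * π / 2) ^ 2 ≤ heatDelta n / π * 1 := by
        gcongr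
        · exact div_nonneg hδ.1 hπ.le
        · exact Real.cos_sq_le_one _
    _ ≤ 2 / π := by rw [mul_one]; gcongr; exact hδ.2

theorem summable_one_div_one_add_sq : Summable fun n : ℕ => 1 / (1 + (n : ℝ) ^ 2) := by
  rw [← summable_nat_add_iff 1]
  refine Summable.of_nonneg_of_le (fun n => by positivity) (fun n => ?_)
    ((summable_nat_add_iff 1).2 (Real.summable_one_div_nat_pow.2 one_lt_two))
  exact one_div_le_one_div_of_le (by positivity) (by linarith)

theorem summable_exp_neg_two_mul_one_add_sq {s : ℝ} (hs : 0 < s) :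
    Summable fun n : ℕ => Real.exp (-(2 * (1 + (n : ℝ) ^ 2)) * s) := by
  refine Summable.of_nonneg_of_le (fun n => (Real.exp_pos _).le) (fun n => ?_)
    (summable_one_div_one_add_sq.mul_left (1 / (2 * s)))
  rw [neg_mul, Real.exp_neg, ← one_div, one_div_mul_one_div]
  refine one_div_le_one_div_of_le (by positivity) ?_
  linarith [Real.add_one_le_exp (2 * (1 + (n : ℝ) ^ 2) * s)]

theorem integral_exp_neg_two_mul_one_add_sq (n : ℕ) :
    ∫ s in Ioi (0 : ℝ), Real.exp (-(2 * (1 + (n : ℝ) ^ 2)) * s) =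
      1 / 2 * (1 / (1 + (n : ℝ) ^ 2)) := by
  have h : (0 : ℝ) < 1 + (n : ℝ) ^ 2 := by positivity
  rw [integral_exp_mul_Ioi (by linarith)]
  simp
  field_simp

theorem integral_tsum_exp_neg_two_mul_one_add_sq :
    ∫ s in Ioi (0 : ℝ), ∑' n : ℕ, Real.exp (-(2 * (1 + (n : ℝ) ^ 2)) * s) =
      1 / 2 * ∑' n : ℕ, 1 / (1 + (n : ℝ) ^ 2) := by
  rw [← integral_tsum_of_summable_integral_norm, ← tsum_mul_left]
  · simp_rw [integral_exp_neg_two_mul_one_add_sq]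
  · intro n
    have h : (0 : ℝ) < 1 + (n : ℝ) ^ 2 := by positivity
    exact integrableOn_exp_mul_Ioi (by linarith) 0
  · simp_rw [Real.norm_eq_abs, Real.abs_exp, integral_exp_neg_two_mul_one_add_sq]
    exact summable_one_div_one_add_sq.mul_left _

theorem integrableOn_tsum_exp_neg_two_mul_one_add_sq :
    IntegrableOn (fun s : ℝ => ∑' n : ℕ, Real.exp (-(2 * (1 + (n : ℝ) ^ 2)) * s)) (Ioi 0) := by
  refine Integrable.of_integral_ne_zero ?_
  rw [integral_tsum_exp_neg_two_mul_one_add_sq]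
  have := summable_one_div_one_add_sq.tsum_pos (fun n => by positivity) 0 (by simp)
  positivity

theorem summable_and_sq_norm_tsum_heat_le {z : ℕ → ℂ} (hz : Summable fun n => ‖z n‖ ^ 2)
    {s : ℝ} (hs : 0 < s) :
    (Summable fun n : ℕ => ‖(heatC n * Real.exp (-((1 + (n : ℝ) ^ 2) * s))) • z n‖) ∧
      ‖∑' n : ℕ, (heatC n * Real.exp (-((1 + (n : ℝ) ^ 2) * s))) • z n‖ ^ 2 ≤
        2 / π * (∑' n : ℕ, ‖z n‖ ^ 2) *
          ∑' n : ℕ, Real.exp (-(2 * (1 + (n : ℝ) ^ 2)) * s) := by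
  have hle (n : ℕ) : ‖heatC n * Real.exp (-((1 + (n : ℝ) ^ 2) * s))‖ ^ 2 ≤
      2 / π * Real.exp (-(2 * (1 + (n : ℝ) ^ 2)) * s) := by
    rw [Real.norm_eq_abs, sq_abs, mul_pow, ← Real.exp_nat_mul]
    have he : ((2 : ℕ) : ℝ) * -((1 + (n : ℝ) ^ 2) * s) = -(2 * (1 + (n : ℝ) ^ 2)) * s := by
      push_cast; ring
    rw [he]
    gcongr
    exact heatC_sq_le n
  have hE := (summable_exp_neg_two_mul_one_add_sq hs).mul_left (2 / π)
  have hc := Summable.of_nonneg_of_le (fun n => sq_nonneg _) hle hE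
  obtain ⟨h₁, h₂⟩ := summable_and_sq_tsum_mul_le (fun n => norm_nonneg _)
    (fun n => norm_nonneg (z n)) hc hz
  simp_rw [← norm_smul] at h₁ h₂
  refine ⟨h₁, ?_⟩
  calc _ ≤ (∑' n : ℕ, ‖(heatC n * Real.exp (-((1 + (n : ℝ) ^ 2) * s))) • z n‖) ^ 2 := by
        gcongr
        exact norm_tsum_le_tsum_norm h₁
    _ ≤ _ := h₂
    _ ≤ (∑' n : ℕ, 2 / π * Real.exp (-(2 * (1 + (n : ℝ) ^ 2)) * s)) * ∑' n, ‖z n‖ ^ 2 := by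
        exact mul_le_mul_of_nonneg_right (hc.tsum_le_tsum hle hE) (tsum_nonneg fun n => sq_nonneg _)
    _ = _ := by rw [tsum_mul_left]; ring

/-- 2-admissibility of the point observation operator for the
heat equation (Proposition 6.2 of the paper): for `z ∈ ℓ²(ℕ,ℂ)` the series
`∑ c_n e^{-(1+n²)s} z_n` converges absolutely for every `s > 0`, and
`∫₀^{t₀} |∑ c_n e^{-(1+n²)s} z_n|² ds ≤ (1/π)(∑ 1/(1+n²))‖z‖²`. -/
theorem stmt_13 (t₀ : ℝ) (ht₀ : 0 < t₀) (z : ℕ → ℂ)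
    (hz : Summable (fun n : ℕ => ‖z n‖ ^ 2)) :
    (∀ s : ℝ, 0 < s →
      Summable (fun n : ℕ =>
        ‖(heatC n * Real.exp (-((1 + (n : ℝ) ^ 2) * s))) • z n‖)) ∧
    ∫ s in Icc (0 : ℝ) t₀,
        ‖∑' n : ℕ, (heatC n * Real.exp (-((1 + (n : ℝ) ^ 2) * s))) • z n‖ ^ 2 ≤
      (1 / π) * (∑' n : ℕ, 1 / (1 + (n : ℝ) ^ 2)) * ∑' n : ℕ, ‖z n‖ ^ 2 := by
  refine ⟨fun s hs => (summable_and_sq_norm_tsum_heat_le hz hs).1, ?_⟩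
  have hint := integrableOn_tsum_exp_neg_two_mul_one_add_sq.const_mul
    (2 / π * ∑' n : ℕ, ‖z n‖ ^ 2)
  have hZ : 0 ≤ ∑' n : ℕ, ‖z n‖ ^ 2 := tsum_nonneg fun n => sq_nonneg _
  have hπ := Real.pi_pos
  rw [integral_Icc_eq_integral_Ioc]
  calc _ ≤ ∫ s in Ioc (0 : ℝ) t₀, 2 / π * (∑' n : ℕ, ‖z n‖ ^ 2) *
          ∑' n : ℕ, Real.exp (-(2 * (1 + (n : ℝ) ^ 2)) * s) := by
        refine integral_mono_of_nonneg (.of_forall fun s => by positivity)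
          (IntegrableOn.mono_set hint Ioc_subset_Ioi_self) ?_
        filter_upwards [ae_restrict_mem measurableSet_Ioc] with s hs
        exact (summable_and_sq_norm_tsum_heat_le hz hs.1).2
    _ ≤ ∫ s in Ioi (0 : ℝ), 2 / π * (∑' n : ℕ, ‖z n‖ ^ 2) *
          ∑' n : ℕ, Real.exp (-(2 * (1 + (n : ℝ) ^ 2)) * s) := by
        refine setIntegral_mono_set hint (.of_forall fun s => ?_)
          Ioc_subset_Ioi_self.eventuallyLE
        exact mul_nonneg (by positivity) (tsum_nonneg fun n => (Real.exp_pos _).le)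
    _ = _ := by
        rw [integral_const_mul, integral_tsum_exp_neg_two_mul_one_add_sq]
        ring
end
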